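/- Let s_n = r_0 + r_1 + … + r_{n−1} for n ≥ 1, and for j ∈ ℤ \ {0} let τ_j = inf{n ≥ 1 : s_n = j} (with τ_j = ∞ if no such n exists, and (1/2)^∞ interpreted as 0). Then height(f) = Σ_{j∈ℤ} (1/2)^{τ_{2j−1}} (sum over all j ∈ ℤ, where the index j = 0 contributes the term (1/2)^{τ_{−1}}), and in particular 1/2 ≤ height(f) ≤ 2/3. -/

import Mathlib

/-- `phi x` is the distance from `x` to the nearest integer. -/
noncomputable def phi (x : ℝ) : ℝ := |x - round x|

/-- The signed Takagi function associated to the sign sequence `r`. -/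
noncomputable def takagi (r : ℕ → ℝ) (x : ℝ) : ℝ :=
  ∑' n : ℕ, r n / 2 ^ n * phi (2 ^ n * x)

/-- `tau r j` is the first time `n ≥ 1` at which the partial sum
`s_n = r_0 + ⋯ + r_{n-1}` equals `j` (and `⊤` if there is no such time). -/
noncomputable def tau (r : ℕ → ℝ) (j : ℤ) : ℕ∞ :=
  sInf {t : ℕ∞ | ∃ n : ℕ, (n : ℕ∞) = t ∧ 1 ≤ n ∧ (∑ i ∈ Finset.range n, r i) = (j : ℝ)}

/-- `(1/2)^t` for `t ∈ ℕ∞`, with the convention `(1/2)^∞ = 0`. -/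
noncomputable def halfPow (t : ℕ∞) : ℝ :=
  WithTop.recTopCoe 0 (fun n : ℕ => (1 / 2 : ℝ) ^ n) t

/-- The height of the graph of the signed Takagi function `f_r`:
`height(f) = max_{x ∈ [0,1]} f(x) - min_{x ∈ [0,1]} f(x)` (the function is
continuous, so the sup and inf over `[0,1]` are attained). -/
noncomputable def heightf (r : ℕ → ℝ) : ℝ :=
  sSup (takagi r '' Set.Icc 0 1) - sInf (takagi r '' Set.Icc 0 1)

theorem phi_nonneg (x : ℝ) : 0 ≤ phi x := abs_nonneg _

theorem phi_le_half (x : ℝ) : phi x ≤ 1 / 2 := abs_sub_round x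

theorem phi_intCast_sub (m : ℤ) (x : ℝ) : phi (m - x) = phi x := by
  apply le_antisymm
  · calc phi (m - x) ≤ |(m - x) - ((m - round x : ℤ) : ℝ)| := round_le _ _
      _ = phi x := by
        rw [phi, ← abs_neg]
        push_cast
        ring_nf
  · calc phi x ≤ |x - ((m - round ((m : ℝ) - x) : ℤ) : ℝ)| := round_le _ _
      _ = phi (m - x) := by
        rw [phi, ← abs_neg]
        push_cast
        ring_nf

theorem phi_eq_self {x : ℝ} (h0 : 0 ≤ x) (h1 : x ≤ 1 / 2) : phi x = x := by
  apply le_antisymm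
  · simpa [phi, abs_of_nonneg h0] using round_le x 0
  · rcases lt_or_ge 0 (round x) with h | h
    · have h' : (1 : ℝ) ≤ round x := by exact_mod_cast h
      rw [phi, abs_sub_comm]
      exact le_trans (by linarith) (le_abs_self _)
    · have h' : (round x : ℝ) ≤ 0 := by exact_mod_cast h
      exact le_trans (by linarith) (le_abs_self _)

/-- All terms of the sequence are `1` or `-1`. -/
def IsSign (r : ℕ → ℝ) : Prop := ∀ n, r n = 1 ∨ r n = -1

/-- The sequence with its first term removed. -/
def tailSeq (r : ℕ → ℝ) : ℕ → ℝ := fun n => r (n + 1)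

theorem IsSign.tail {r : ℕ → ℝ} (hr : IsSign r) : IsSign (tailSeq r) := fun n => hr (n + 1)

theorem IsSign.neg {r : ℕ → ℝ} (hr : IsSign r) : IsSign (-r) := fun n => by
  rcases hr n with h | h <;> simp [h]

theorem IsSign.abs {r : ℕ → ℝ} (hr : IsSign r) (n : ℕ) : |r n| = 1 := by
  rcases hr n with h | h <;> simp [h]

theorem IsSign.norm_term_le {r : ℕ → ℝ} (hr : IsSign r) (x : ℝ) (n : ℕ) :
    ‖r n / 2 ^ n * phi (2 ^ n * x)‖ ≤ 1 / 2 / 2 ^ n := by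
  rw [norm_mul, norm_div, Real.norm_eq_abs, hr.abs, Real.norm_eq_abs, Real.norm_eq_abs,
    abs_of_nonneg (phi_nonneg _), abs_of_nonneg (by positivity : (0 : ℝ) ≤ 2 ^ n), div_mul_eq_mul_div,
    one_mul]
  gcongr
  exact phi_le_half _

theorem IsSign.summable_term {r : ℕ → ℝ} (hr : IsSign r) (x : ℝ) :
    Summable fun n : ℕ => r n / 2 ^ n * phi (2 ^ n * x) :=
  Summable.of_norm_bounded (hasSum_geometric_two' 1).summable
    (hr.norm_term_le x)

theorem IsSign.abs_takagi_le {r : ℕ → ℝ} (hr : IsSign r) (x : ℝ) : |takagi r x| ≤ 1 := by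
  have h := tsum_of_norm_bounded (hasSum_geometric_two' 1) fun n => (hr.norm_term_le x n)
  simpa [takagi] using h

theorem IsSign.takagi_eq {r : ℕ → ℝ} (hr : IsSign r) (x : ℝ) :
    takagi r x = r 0 * phi x + 1 / 2 * takagi (tailSeq r) (2 * x) := by
  rw [takagi, (hr.summable_term x).tsum_eq_zero_add, takagi, ← tsum_mul_left]
  simp only [pow_zero, div_one, one_mul, tailSeq]
  congr 2
  funext n
  rw [pow_succ, mul_assoc (2 ^ n) 2 x]
  field_simp

theorem takagi_one_sub (r : ℕ → ℝ) (x : ℝ) : takagi r (1 - x) = takagi r x := by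
  unfold takagi
  congr 1
  funext n
  have h := phi_intCast_sub (2 ^ n) (2 ^ n * x)
  push_cast at h
  rw [mul_sub, mul_one, h]

theorem takagi_neg (r : ℕ → ℝ) (x : ℝ) : takagi (-r) x = -takagi r x := by
  simp [takagi, neg_div, tsum_neg]

theorem takagi_zero (r : ℕ → ℝ) : takagi r 0 = 0 := by simp [takagi, phi]

/-- The supremum over `[0, 1]` of the Takagi function tilted by a linear function of slope `-a`. -/
noncomputable def tiltedSup (a : ℝ) (r : ℕ → ℝ) : ℝ :=
  sSup ((fun x => takagi r x - a * x) '' Set.Icc 0 1)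

section
variable {r : ℕ → ℝ} (hr : IsSign r)
include hr

theorem le_tiltedSup (a : ℝ) {x : ℝ} (hx : x ∈ Set.Icc (0 : ℝ) 1) :
    takagi r x - a * x ≤ tiltedSup a r := by
  refine le_csSup ⟨1 + |a|, ?_⟩ ⟨x, hx, rfl⟩
  rintro _ ⟨y, hy, rfl⟩
  have h1 := (abs_le.1 (hr.abs_takagi_le y)).2
  have h2 : |a * y| ≤ |a| := by
    rw [abs_mul, abs_of_nonneg hy.1]
    exact mul_le_of_le_one_right (abs_nonneg a) hy.2
  have h3 := (abs_le.1 h2).1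
  dsimp only
  linarith

omit hr in
theorem tiltedSup_le {a c : ℝ} (h : ∀ x ∈ Set.Icc (0 : ℝ) 1, takagi r x - a * x ≤ c) :
    tiltedSup a r ≤ c := by
  refine csSup_le ((Set.nonempty_Icc.2 zero_le_one).image _) ?_
  rintro _ ⟨y, hy, rfl⟩
  exact h y hy

theorem tiltedSup_nonneg (a : ℝ) : 0 ≤ tiltedSup a r := by
  simpa [takagi_zero] using le_tiltedSup hr a (x := 0) (by simp)

theorem tiltedSup_le_one {a : ℝ} (ha : 0 ≤ a) : tiltedSup a r ≤ 1 :=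
  tiltedSup_le fun x hx => by
    have h1 := (abs_le.1 (hr.abs_takagi_le x)).2
    have h2 := mul_nonneg ha hx.1
    linarith

theorem tiltedSup_neg_le (a : ℝ) : tiltedSup (-a) r ≤ a + tiltedSup a r :=
  tiltedSup_le fun x hx => by
    have h := le_tiltedSup hr a (x := 1 - x) ⟨by linarith [hx.2], by linarith [hx.1]⟩
    rw [takagi_one_sub] at h
    linarith

theorem tiltedSup_neg (a : ℝ) : tiltedSup (-a) r = a + tiltedSup a r := by
  have h1 := tiltedSup_neg_le hr a
  have h2 := tiltedSup_neg_le hr (-a)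
  rw [neg_neg] at h2
  linarith

theorem tiltedSup_eq {a : ℝ} (ha : 0 ≤ a) :
    tiltedSup a r = 1 / 2 * tiltedSup (a - r 0) (tailSeq r) := by
  have key : ∀ x : ℝ, 0 ≤ x → x ≤ 1 / 2 →
      takagi r x - a * x =
        1 / 2 * (takagi (tailSeq r) (2 * x) - (a - r 0) * (2 * x)) := fun x h0 h1 => by
    rw [hr.takagi_eq, phi_eq_self h0 h1]
    ring
  have half : ∀ x : ℝ, 0 ≤ x → x ≤ 1 / 2 →
      takagi r x - a * x ≤ 1 / 2 * tiltedSup (a - r 0) (tailSeq r) := fun x h0 h1 => by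
    rw [key x h0 h1]
    have := le_tiltedSup hr.tail (a - r 0) (x := 2 * x) ⟨by linarith, by linarith⟩
    linarith
  apply le_antisymm
  · refine tiltedSup_le fun x hx => ?_
    rcases le_total x (1 / 2) with h | h
    · exact half x hx.1 h
    · have h1 := half (1 - x) (by linarith [hx.2]) (by linarith)
      rw [takagi_one_sub] at h1
      have h2 : a * (1 - x) ≤ a * x := by gcongr; linarith
      linarith
  · have : tiltedSup (a - r 0) (tailSeq r) ≤ 2 * tiltedSup a r := tiltedSup_le fun y hy => by
      have h0 : 0 ≤ y / 2 := by linarith [hy.1]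
      have h1 : y / 2 ≤ 1 / 2 := by linarith [hy.2]
      have h2 := key (y / 2) h0 h1
      rw [mul_div_cancel₀ y two_ne_zero] at h2
      have h3 := le_tiltedSup hr a (x := y / 2) ⟨h0, by linarith⟩
      linarith
    linarith

end

/-- The recursion under the first step of the walk which characterises both `tiltedSup` and the
sum of the powers `(1/2) ^ τ`. -/
structure WalkRecursion (F : ℕ → (ℕ → ℝ) → ℝ) : Prop where
  nonneg : ∀ a r, IsSign r → 0 ≤ F a r
  le_one : ∀ a r, IsSign r → F a r ≤ 1
  down : ∀ a r, IsSign r → r 0 = -1 → F a r = 1 / 2 * F (a + 1) (tailSeq r)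
  up : ∀ a r, IsSign r → r 0 = 1 → F (a + 1) r = 1 / 2 * F a (tailSeq r)
  up_zero : ∀ r, IsSign r → r 0 = 1 → F 0 r = 1 / 2 + 1 / 2 * F 1 (tailSeq r)

theorem le_of_forall_le_add_pow {x y C : ℝ} (h : ∀ k : ℕ, x ≤ y + C * (1 / 2) ^ k) : x ≤ y := by
  have ht : Filter.Tendsto (fun k : ℕ => y + C * (1 / 2 : ℝ) ^ k) Filter.atTop (nhds y) := by
    simpa using ((tendsto_pow_atTop_nhds_zero_of_lt_one (r := (1 / 2 : ℝ)) (by norm_num)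
      (by norm_num)).const_mul C).const_add y
  exact ge_of_tendsto' ht h

namespace WalkRecursion

theorem le {F G : ℕ → (ℕ → ℝ) → ℝ} (hF : WalkRecursion F) (hG : WalkRecursion G) (a : ℕ)
    {r : ℕ → ℝ} (hr : IsSign r) : F a r ≤ G a r := by
  refine le_of_forall_le_add_pow (C := 1) fun k => ?_
  induction k generalizing a r with
  | zero => linarith [hF.le_one a r hr, hG.nonneg a r hr, pow_zero (1 / 2 : ℝ)]
  | succ k ih =>
    rw [pow_succ]
    rcases hr 0 with h | h
    · rcases a with _ | a
      · rw [hF.up_zero r hr h, hG.up_zero r hr h]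
        linarith [ih 1 hr.tail]
      · rw [hF.up a r hr h, hG.up a r hr h]
        linarith [ih a hr.tail]
    · rw [hF.down a r hr h, hG.down a r hr h]
      linarith [ih (a + 1) hr.tail]

variable {F : ℕ → (ℕ → ℝ) → ℝ} (hF : WalkRecursion F)
include hF

theorem half_le {r : ℕ → ℝ} (hr : IsSign r) : 1 / 2 ≤ F 0 r + F 0 (-r) := by
  rcases hr 0 with h | h
  · rw [hF.up_zero r hr h]
    linarith [hF.nonneg 1 _ hr.tail, hF.nonneg 0 _ hr.neg]
  · rw [hF.up_zero (-r) hr.neg (by simp [h])]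
    linarith [hF.nonneg 1 _ hr.neg.tail, hF.nonneg 0 _ hr]

theorem add_neg_le_of_up (k : ℕ)
    (ih : ∀ (a b : ℕ) (r : ℕ → ℝ), IsSign r →
      (Even a → Even b → F a r + F b (-r) ≤ 2 / 3 + 2 * (1 / 2) ^ k) ∧
      (Odd a → Odd b → F a r + F b (-r) ≤ 1 / 3 + 2 * (1 / 2) ^ k))
    (a b : ℕ) {r : ℕ → ℝ} (hr : IsSign r) (h : r 0 = 1) :
    (Even a → Even b → F a r + F b (-r) ≤ 2 / 3 + 2 * (1 / 2) ^ (k + 1)) ∧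
    (Odd a → Odd b → F a r + F b (-r) ≤ 1 / 3 + 2 * (1 / 2) ^ (k + 1)) := by
  have hs : tailSeq (-r) = -tailSeq r := rfl
  rw [pow_succ, hF.down b (-r) hr.neg (by simp [h]), hs]
  have hp : (0 : ℝ) ≤ (1 / 2) ^ k := by positivity
  rcases a with _ | a
  · rw [hF.up_zero r hr h]
    refine ⟨fun _ hb => ?_, fun ha => absurd ha (by decide)⟩
    linarith [(ih 1 (b + 1) _ hr.tail).2 odd_one hb.add_one]
  · rw [hF.up a r hr h]
    refine ⟨fun ha hb => ?_, fun ha hb => ?_⟩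
    · have ha' : Odd a := by grind
      linarith [(ih a (b + 1) _ hr.tail).2 ha' hb.add_one]
    · have ha' : Even a := by grind
      linarith [(ih a (b + 1) _ hr.tail).1 ha' hb.add_one]

theorem add_neg_le (k : ℕ) (a b : ℕ) {r : ℕ → ℝ} (hr : IsSign r) :
    (Even a → Even b → F a r + F b (-r) ≤ 2 / 3 + 2 * (1 / 2) ^ k) ∧
    (Odd a → Odd b → F a r + F b (-r) ≤ 1 / 3 + 2 * (1 / 2) ^ k) := by
  induction k generalizing a b r with
  | zero =>
    have h1 := hF.le_one a _ hr
    have h2 := hF.le_one b _ hr.neg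
    rw [pow_zero]
    constructor <;> intros <;> linarith
  | succ k ih =>
    rcases hr 0 with h | h
    · exact hF.add_neg_le_of_up k (fun a b r hr => ih a b hr) a b hr h
    · have := hF.add_neg_le_of_up k (fun a b r hr => ih a b hr) b a hr.neg (by simp [h])
      rw [neg_neg] at this
      simpa only [add_comm] using And.intro (fun h1 h2 => this.1 h2 h1) (fun h1 h2 => this.2 h2 h1)

theorem le_two_thirds {r : ℕ → ℝ} (hr : IsSign r) : F 0 r + F 0 (-r) ≤ 2 / 3 :=
  le_of_forall_le_add_pow fun k => (hF.add_neg_le k 0 0 hr).1 Even.zero Even.zero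

end WalkRecursion

theorem walkRecursion_tiltedSup : WalkRecursion fun a r => tiltedSup a r where
  nonneg a r hr := tiltedSup_nonneg hr a
  le_one a r hr := tiltedSup_le_one hr a.cast_nonneg
  down a r hr h := by
    rw [tiltedSup_eq hr a.cast_nonneg, h]
    simp
  up a r hr h := by
    rw [tiltedSup_eq hr (a + 1).cast_nonneg, h]
    simp
  up_zero r hr h := by
    rw [tiltedSup_eq hr (Nat.cast_nonneg 0), h, Nat.cast_zero, zero_sub, tiltedSup_neg hr.tail,
      Nat.cast_one]
    ring

theorem heightf_eq (r : ℕ → ℝ) : heightf r = tiltedSup 0 r + tiltedSup 0 (-r) := by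
  have h : (fun x => takagi (-r) x) '' Set.Icc 0 1 = -(takagi r '' Set.Icc 0 1) := by
    rw [← Set.image_neg_eq_neg, Set.image_image]
    simp only [takagi_neg]
  simp only [tiltedSup, zero_mul, sub_zero, h, Real.sSup_neg, heightf]
  ring

theorem halfPow_natCast (n : ℕ) : halfPow n = (1 / 2) ^ n := rfl

theorem halfPow_top : halfPow ⊤ = 0 := rfl

/-- `n` is the first time at which the walk hits `j`. -/
def IsFirstHit (r : ℕ → ℝ) (j : ℤ) (n : ℕ) : Prop :=
  (1 ≤ n ∧ ∑ i ∈ Finset.range n, r i = j) ∧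
    ∀ m, 1 ≤ m → ∑ i ∈ Finset.range m, r i = j → n ≤ m

theorem IsFirstHit.tau_eq {r : ℕ → ℝ} {j : ℤ} {n : ℕ} (h : IsFirstHit r j n) : tau r j = n := by
  apply le_antisymm
  · exact sInf_le ⟨n, rfl, h.1⟩
  · refine le_sInf ?_
    rintro _ ⟨m, rfl, h1, h2⟩
    exact_mod_cast h.2 m h1 h2

theorem tau_eq_top {r : ℕ → ℝ} {j : ℤ}
    (h : ∀ m, 1 ≤ m → ∑ i ∈ Finset.range m, r i ≠ j) : tau r j = ⊤ := by
  refine sInf_eq_top.2 ?_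
  rintro _ ⟨m, rfl, h1, h2⟩
  exact absurd h2 (h m h1)

theorem exists_isFirstHit_or (r : ℕ → ℝ) (j : ℤ) :
    (∃ n, IsFirstHit r j n) ∨ ∀ m, 1 ≤ m → ∑ i ∈ Finset.range m, r i ≠ j := by
  classical
  by_cases h : ∃ n, 1 ≤ n ∧ ∑ i ∈ Finset.range n, r i = j
  · exact .inl ⟨Nat.find h, Nat.find_spec h, fun m h1 h2 => Nat.find_min' h ⟨h1, h2⟩⟩
  · exact .inr fun m h1 h2 => h ⟨m, h1, h2⟩

theorem halfPow_tau_nonneg (r : ℕ → ℝ) (j : ℤ) : 0 ≤ halfPow (tau r j) := by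
  rcases exists_isFirstHit_or r j with ⟨n, h⟩ | h
  · rw [h.tau_eq, halfPow_natCast]
    positivity
  · rw [tau_eq_top h, halfPow_top]

theorem IsSign.halfPow_tau_le {r : ℕ → ℝ} (hr : IsSign r) (b : ℕ) :
    halfPow (tau r b) ≤ (1 / 2) ^ b := by
  rcases exists_isFirstHit_or r b with ⟨n, h⟩ | h
  · rw [h.tau_eq, halfPow_natCast]
    refine pow_le_pow_of_le_one (by norm_num) (by norm_num) ?_
    have h1 : ∑ i ∈ Finset.range n, r i ≤ ∑ i ∈ Finset.range n, 1 :=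
      Finset.sum_le_sum fun i _ => (le_abs_self _).trans (hr.abs i).le
    rw [h.1.2] at h1
    simpa using h1
  · rw [tau_eq_top h, halfPow_top]
    positivity

theorem tau_neg (r : ℕ → ℝ) (j : ℤ) : tau (-r) j = tau r (-j) := by
  simp [tau, neg_eq_iff_eq_neg]

theorem halfPow_tau_first {r : ℕ → ℝ} {j : ℤ} (h : r 0 = j) : halfPow (tau r j) = 1 / 2 := by
  have : IsFirstHit r j 1 := ⟨⟨le_rfl, by simpa using h⟩, fun m hm _ => hm⟩
  rw [this.tau_eq, halfPow_natCast, pow_one]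

theorem sum_range_succ_eq_iff {r : ℕ → ℝ} {e j : ℤ} (h : r 0 = e) (m : ℕ) :
    ∑ i ∈ Finset.range (m + 1), r i = j ↔ ∑ i ∈ Finset.range m, tailSeq r i = (j - e : ℤ) := by
  rw [Finset.sum_range_succ', h, Int.cast_sub, eq_sub_iff_add_eq]
  rfl

theorem halfPow_tau_tailSeq {r : ℕ → ℝ} {e j : ℤ} (h : r 0 = e) (hj : j ≠ e) :
    halfPow (tau r j) = 1 / 2 * halfPow (tau (tailSeq r) (j - e)) := by
  have hpos : ∀ m, 1 ≤ m → ∑ i ∈ Finset.range m, r i = j →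
      ∃ k, m = k + 1 ∧ 1 ≤ k ∧ ∑ i ∈ Finset.range k, tailSeq r i = (j - e : ℤ) := by
    intro m hm hs
    obtain ⟨k, rfl⟩ := Nat.exists_eq_add_of_le' hm
    rw [sum_range_succ_eq_iff h] at hs
    refine ⟨k, rfl, Nat.one_le_iff_ne_zero.2 ?_, hs⟩
    rintro rfl
    rw [Finset.sum_range_zero, eq_comm, Int.cast_eq_zero] at hs
    exact hj (sub_eq_zero.1 hs)
  rcases exists_isFirstHit_or (tailSeq r) (j - e) with ⟨n, hn⟩ | hn
  · have : IsFirstHit r j (n + 1) := by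
      refine ⟨⟨by omega, (sum_range_succ_eq_iff h n).2 hn.1.2⟩, fun m hm hs => ?_⟩
      obtain ⟨k, rfl, hk, hs⟩ := hpos m hm hs
      exact Nat.succ_le_succ (hn.2 k hk hs)
    rw [this.tau_eq, hn.tau_eq, halfPow_natCast, halfPow_natCast, pow_succ']
  · rw [tau_eq_top hn, tau_eq_top, halfPow_top, mul_zero]
    intro m hm hs
    obtain ⟨k, -, hk, hs⟩ := hpos m hm hs
    exact hn k hk hs

/-- The sum of `(1/2) ^ τ` over the levels `a + 1, a + 3, a + 5, …`. -/
noncomputable def hitSum (a : ℕ) (r : ℕ → ℝ) : ℝ :=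
  ∑' j : ℕ, halfPow (tau r (a + 2 * j + 1))

theorem IsSign.halfPow_tau_le_geometric {r : ℕ → ℝ} (hr : IsSign r) (a j : ℕ) :
    halfPow (tau r (a + 2 * j + 1)) ≤ 1 / 2 / 2 ^ j := by
  have h := hr.halfPow_tau_le (a + 2 * j + 1)
  push_cast at h
  refine h.trans ?_
  calc (1 / 2 : ℝ) ^ (a + 2 * j + 1) ≤ (1 / 2) ^ (j + 1) :=
        pow_le_pow_of_le_one (by norm_num) (by norm_num) (by omega)
    _ = 1 / 2 / 2 ^ j := by rw [pow_succ', one_div_pow, mul_one_div]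

theorem IsSign.summable_halfPow_tau {r : ℕ → ℝ} (hr : IsSign r) (a : ℕ) :
    Summable fun j : ℕ => halfPow (tau r (a + 2 * j + 1)) :=
  Summable.of_nonneg_of_le (fun _ => halfPow_tau_nonneg _ _) (hr.halfPow_tau_le_geometric a)
    (hasSum_geometric_two' 1).summable

theorem walkRecursion_hitSum : WalkRecursion hitSum where
  nonneg a r hr := tsum_nonneg fun _ => halfPow_tau_nonneg _ _
  le_one a r hr := hasSum_le (hr.halfPow_tau_le_geometric a) (hr.summable_halfPow_tau a).hasSum
    (hasSum_geometric_two' 1)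
  down a r hr h := by
    rw [hitSum, hitSum, ← tsum_mul_left]
    refine tsum_congr fun j => ?_
    rw [halfPow_tau_tailSeq (e := -1) (by simpa using h) (by omega)]
    congr 3
    push_cast
    ring
  up a r hr h := by
    rw [hitSum, hitSum, ← tsum_mul_left]
    refine tsum_congr fun j => ?_
    rw [halfPow_tau_tailSeq (e := 1) (by simpa using h) (by omega)]
    congr 3
    push_cast
    ring
  up_zero r hr h := by
    rw [hitSum, (hr.summable_halfPow_tau 0).tsum_eq_zero_add, hitSum, ← tsum_mul_left]
    congr 1
    · exact halfPow_tau_first (by simpa using h)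
    · refine tsum_congr fun j => ?_
      rw [halfPow_tau_tailSeq (e := 1) (by simpa using h) (by omega)]
      congr 3
      push_cast
      ring

theorem IsSign.tsum_halfPow_tau {r : ℕ → ℝ} (hr : IsSign r) :
    ∑' j : ℤ, halfPow (tau r (2 * j - 1)) = hitSum 0 r + hitSum 0 (-r) := by
  rw [← (Equiv.addRight (1 : ℤ)).tsum_eq]
  refine (HasSum.of_nat_of_neg_add_one ?_ ?_).tsum_eq
  · refine (hr.summable_halfPow_tau 0).hasSum.congr_fun fun j => ?_
    rw [Equiv.coe_addRight]
    congr 2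
    push_cast
    ring
  · refine (hr.neg.summable_halfPow_tau 0).hasSum.congr_fun fun j => ?_
    rw [tau_neg, Equiv.coe_addRight]
    congr 2
    push_cast
    ring

/-- The height of a signed Takagi function satisfies
`height(f) = ∑_{j ∈ ℤ} (1/2)^{τ_{2j-1}}`, and in particular
`1/2 ≤ height(f) ≤ 2/3`. -/
theorem signed_takagi_height (r : ℕ → ℝ) (hr : ∀ n, r n = 1 ∨ r n = -1) :
    heightf r = (∑' j : ℤ, halfPow (tau r (2 * j - 1))) ∧
      1 / 2 ≤ heightf r ∧ heightf r ≤ 2 / 3 := by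
  have hs : IsSign r := hr
  have key : ∀ {q : ℕ → ℝ}, IsSign q → tiltedSup 0 q = hitSum 0 q := fun hq => by
    simpa using le_antisymm (walkRecursion_tiltedSup.le walkRecursion_hitSum 0 hq)
      (walkRecursion_hitSum.le walkRecursion_tiltedSup 0 hq)
  rw [heightf_eq, key hs, key hs.neg, hs.tsum_halfPow_tau]
  exact ⟨rfl, walkRecursion_hitSum.half_le hs, walkRecursion_hitSum.le_two_thirds hs⟩
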